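/- Let n ≥ 1 be a natural number and λ ≠ 0 a real constant. If y : ℝ → ℝ is infinitely differentiable, y(x) > 0 for all x, and y satisfies y^(2n)(x) + λ · y(x)^((1+2n)/(1-2n)) = 0 for all x ∈ ℝ, then the function I₃(x) = (x²/2)·(y^(n)(x))² + (-1)^n · λ · x² · ((1-2n)/2) · y(x)^(2/(1-2n)) − (n²/2)·(y^(n-1)(x))² + Σ_{j=0}^{n-1} (-1)^{n-j-1} · ( j(2n-j)·y^(j-1)(x) + (2n-2j-1)·x·y^(j)(x) − x²·y^(j+1)(x) ) · y^(2n-j-1)(x) is constant on ℝ (the term j(2n-j)·y^(j-1) has coefficient 0 when j = 0, so the sum is well defined). -/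

import Mathlib

theorem ContDiff.hasDerivAt_iteratedDeriv {y : ℝ → ℝ} (hy : ContDiff ℝ (⊤ : ℕ∞) y)
    (k : ℕ) (x : ℝ) : HasDerivAt (iteratedDeriv k y) (iteratedDeriv (k + 1) y x) x := by
  have hk : Differentiable ℝ (iteratedDeriv k y) :=
    hy.differentiable_iteratedDeriv k (by exact_mod_cast WithTop.coe_lt_top k)
  rw [iteratedDeriv_succ]
  exact (hk x).hasDerivAt

/-- The `j`-th derivative of the characteristic `(2n-1) x y - x² y'` of the projective symmetry. -/
noncomputable def projectiveCharacteristic (n : ℕ) (y : ℝ → ℝ) (j : ℕ) (x : ℝ) : ℝ :=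
  (j : ℝ) * (2 * (n : ℝ) - (j : ℝ)) * iteratedDeriv (j - 1) y x
    + (2 * (n : ℝ) - 2 * (j : ℝ) - 1) * x * iteratedDeriv j y x
    - x ^ 2 * iteratedDeriv (j + 1) y x

theorem hasDerivAt_projectiveCharacteristic (n : ℕ) {y : ℝ → ℝ}
    (hy : ContDiff ℝ (⊤ : ℕ∞) y) (j : ℕ) (x : ℝ) :
    HasDerivAt (projectiveCharacteristic n y j) (projectiveCharacteristic n y (j + 1) x) x := by
  have hprev : HasDerivAt
      (fun t => (j : ℝ) * (2 * (n : ℝ) - (j : ℝ)) * iteratedDeriv (j - 1) y t)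
      ((j : ℝ) * (2 * (n : ℝ) - (j : ℝ)) * iteratedDeriv j y x) x := by
    rcases j with _ | j
    · simpa using hasDerivAt_const x (0 : ℝ)
    · exact (hy.hasDerivAt_iteratedDeriv j x).const_mul _
  have hmid := ((hasDerivAt_id x).const_mul (2 * (n : ℝ) - 2 * (j : ℝ) - 1)).mul
    (hy.hasDerivAt_iteratedDeriv j x)
  have hlast := (hasDerivAt_pow 2 x).mul (hy.hasDerivAt_iteratedDeriv (j + 1) x)
  refine ((hprev.add hmid).sub hlast).congr_deriv ?_
  simp only [projectiveCharacteristic, Nat.add_sub_cancel, id]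
  push_cast
  ring

/-- The boundary terms of the iterated integration by parts telescope. -/
theorem hasDerivAt_sum_projectiveCharacteristic (n : ℕ) {y : ℝ → ℝ}
    (hy : ContDiff ℝ (⊤ : ℕ∞) y) (x : ℝ) :
    HasDerivAt
      (fun t => ∑ j ∈ Finset.range n, (-1 : ℝ) ^ (n - j - 1) * projectiveCharacteristic n y j t
        * iteratedDeriv (2 * n - j - 1) y t)
      (projectiveCharacteristic n y n x * iteratedDeriv n y x
        - (-1 : ℝ) ^ n * projectiveCharacteristic n y 0 x * iteratedDeriv (2 * n) y x) x := by
  have htel := Finset.sum_range_sub (fun j => (-1 : ℝ) ^ (n - j)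
    * projectiveCharacteristic n y j x * iteratedDeriv (2 * n - j) y x) n
  have hn : 2 * n - n = n := by omega
  simp only [Nat.sub_self, Nat.sub_zero, pow_zero, one_mul, hn] at htel
  rw [← htel]
  refine HasDerivAt.fun_sum fun j hj => ?_
  have hjn := Finset.mem_range.mp hj
  obtain ⟨k, rfl⟩ : ∃ k, n = j + 1 + k := ⟨n - (j + 1), by omega⟩
  have h₁ : j + 1 + k - j = k + 1 := by omega
  have h₂ : 2 * (j + 1 + k) - j = j + 2 * k + 1 + 1 := by omega
  have h₃ : j + 1 + k - (j + 1) = k := by omega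
  have h₄ : 2 * (j + 1 + k) - (j + 1) = j + 2 * k + 1 := by omega
  rw [h₁, h₂, h₃, h₄]
  simp only [Nat.add_sub_cancel]
  refine (((hasDerivAt_projectiveCharacteristic _ hy j x).const_mul ((-1 : ℝ) ^ k)).mul
    (hy.hasDerivAt_iteratedDeriv (j + 2 * k + 1) x)).congr_deriv ?_
  ring


/-- The first integral `I₃` (projective divergence symmetry) of the critical-exponent
equation `y^(2n) + λ y^((1+2n)/(1-2n)) = 0` is constant on solutions. -/
theorem stmt_3 (n : ℕ) (hn : 1 ≤ n) (lam : ℝ) (hlam : lam ≠ 0)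
    (y : ℝ → ℝ) (hy : ContDiff ℝ (⊤ : ℕ∞) y) (hpos : ∀ x, 0 < y x)
    (heq : ∀ x, iteratedDeriv (2 * n) y x
      + lam * (y x) ^ ((1 + 2 * (n : ℝ)) / (1 - 2 * (n : ℝ))) = 0) :
    ∃ C : ℝ, ∀ x : ℝ,
      (x ^ 2 / 2) * (iteratedDeriv n y x) ^ 2
        + (-1 : ℝ) ^ n * lam * x ^ 2 * ((1 - 2 * (n : ℝ)) / 2)
            * (y x) ^ (2 / (1 - 2 * (n : ℝ)))
        - ((n : ℝ) ^ 2 / 2) * (iteratedDeriv (n - 1) y x) ^ 2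
        + ∑ j ∈ Finset.range n, (-1 : ℝ) ^ (n - j - 1)
            * ((j : ℝ) * (2 * (n : ℝ) - (j : ℝ)) * iteratedDeriv (j - 1) y x
                + (2 * (n : ℝ) - 2 * (j : ℝ) - 1) * x * iteratedDeriv j y x
                - x ^ 2 * iteratedDeriv (j + 1) y x)
            * iteratedDeriv (2 * n - j - 1) y x = C := by
  have hn1 : (1 : ℝ) ≤ n := by exact_mod_cast hn
  have hne : 1 - 2 * (n : ℝ) ≠ 0 := by linarith
  set q : ℝ := 2 / (1 - 2 * (n : ℝ)) with hq
  have hqn : (1 - 2 * (n : ℝ)) * q = 2 := by rw [hq]; field_simp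
  have hp : (1 + 2 * (n : ℝ)) / (1 - 2 * (n : ℝ)) = q - 1 := by rw [hq]; field_simp; ring
  rw [hp] at heq
  set F : ℝ → ℝ := fun x => (x ^ 2 / 2) * (iteratedDeriv n y x) ^ 2
    + (-1 : ℝ) ^ n * lam * x ^ 2 * ((1 - 2 * (n : ℝ)) / 2) * (y x) ^ q
    - ((n : ℝ) ^ 2 / 2) * (iteratedDeriv (n - 1) y x) ^ 2
    + ∑ j ∈ Finset.range n, (-1 : ℝ) ^ (n - j - 1) * projectiveCharacteristic n y j x
      * iteratedDeriv (2 * n - j - 1) y x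
  have hderiv : ∀ x, HasDerivAt F 0 x := by
    intro x
    have hyn := hy.hasDerivAt_iteratedDeriv n x
    have hyprev := hy.hasDerivAt_iteratedDeriv (n - 1) x
    rw [Nat.sub_add_cancel hn] at hyprev
    have hy0 := hy.hasDerivAt_iteratedDeriv 0 x
    rw [iteratedDeriv_zero] at hy0
    have hkin := ((hasDerivAt_pow 2 x).div_const 2).mul (hyn.pow 2)
    have hpot := (((hasDerivAt_pow 2 x).const_mul ((-1 : ℝ) ^ n * lam)).mul_const
      ((1 - 2 * (n : ℝ)) / 2)).mul (hy0.rpow_const (p := q) (Or.inl (hpos x).ne'))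
    have hgauge := (hyprev.pow 2).const_mul ((n : ℝ) ^ 2 / 2)
    refine (((hkin.add hpot).sub hgauge).add
      (hasDerivAt_sum_projectiveCharacteristic n hy x)).congr_deriv ?_
    have hyq : (y x) ^ q = (y x) ^ (q - 1) * y x := by
      rw [← Real.rpow_add_one (hpos x).ne', sub_add_cancel]
    have hode : iteratedDeriv (2 * n) y x = -(lam * (y x) ^ (q - 1)) := by
      linarith [heq x]
    rw [hyq, hode]
    simp only [projectiveCharacteristic, iteratedDeriv_zero, Nat.cast_zero, Pi.pow_apply]
    push_cast
    linear_combination ((-1 : ℝ) ^ n * lam * x ^ 2 / 2 * iteratedDeriv (0 + 1) y x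
      * (y x) ^ (q - 1)) * hqn
  refine ⟨F 0, fun x => ?_⟩
  exact is_const_of_deriv_eq_zero (fun t => (hderiv t).differentiableAt)
    (fun t => (hderiv t).deriv) x 0
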